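/- The total probability of a pairwise incompatible set of explanations is at most 1: for any finite index type ι, any p : ι → ℝ with 0 ≤ p i ≤ 1 for all i, and any finite family K of composite choices that is pairwise incompatible, ∑_{(D,v) ∈ K} P(D,v) ≤ 1. -/

import Mathlib

/-- The probability that the Boolean variable `i` takes the value `b`. -/
def boolWeight {ι : Type*} (p : ι → ℝ) (i : ι) (b : Bool) : ℝ :=
  if b = true then p i else 1 - p i

/-- The total choices that extend the composite choice `c`. -/
def choiceCylinder {ι : Type*} [Fintype ι] [DecidableEq ι]
    (c : Finset ι × (ι → Bool)) : Finset (ι → Bool) :=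
  Fintype.piFinset fun i => if i ∈ c.1 then {c.2 i} else Finset.univ

lemma boolWeight_nonneg {ι : Type*} {p : ι → ℝ} (h0 : ∀ i, 0 ≤ p i) (h1 : ∀ i, p i ≤ 1)
    (i : ι) (b : Bool) : 0 ≤ boolWeight p i b := by
  unfold boolWeight
  split_ifs
  exacts [h0 i, sub_nonneg.2 (h1 i)]

lemma sum_boolWeight {ι : Type*} (p : ι → ℝ) (i : ι) : ∑ b, boolWeight p i b = 1 := by
  simp [boolWeight]

lemma sum_prod_boolWeight {ι : Type*} [Fintype ι] [DecidableEq ι] (p : ι → ℝ) :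
    ∑ w : ι → Bool, ∏ i, boolWeight p i (w i) = 1 := by
  rw [← Fintype.piFinset_univ, ← Finset.prod_univ_sum]
  simp only [sum_boolWeight, Finset.prod_const_one]

lemma apply_eq_of_mem_choiceCylinder {ι : Type*} [Fintype ι] [DecidableEq ι]
    {c : Finset ι × (ι → Bool)} {w : ι → Bool} (hw : w ∈ choiceCylinder c) {i : ι}
    (hi : i ∈ c.1) : w i = c.2 i := by
  simpa [hi] using Fintype.mem_piFinset.1 hw i

lemma sum_choiceCylinder_boolWeight {ι : Type*} [Fintype ι] [DecidableEq ι] (p : ι → ℝ)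
    (c : Finset ι × (ι → Bool)) :
    ∑ w ∈ choiceCylinder c, ∏ i, boolWeight p i (w i) =
      (∏ i ∈ c.1.filter (fun i => c.2 i = true), p i) *
        ∏ i ∈ c.1.filter (fun i => c.2 i = false), (1 - p i) := by
  have key (i : ι) : ∑ b ∈ (if i ∈ c.1 then {c.2 i} else Finset.univ), boolWeight p i b =
      if i ∈ c.1 then boolWeight p i (c.2 i) else 1 := by
    split_ifs
    exacts [Finset.sum_singleton _ _, sum_boolWeight p i]
  rw [choiceCylinder, ← Finset.prod_univ_sum, Finset.prod_congr rfl fun i _ => key i,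
    Finset.prod_ite_mem, Finset.univ_inter]
  simp only [boolWeight, Finset.prod_ite, Bool.not_eq_true]

/-- The total probability of a pairwise incompatible set of explanations is at
most `1`: for a finite index type `ι`, `p : ι → ℝ` with `0 ≤ p i ≤ 1`, and a
finite pairwise incompatible family `K` of composite choices,
`∑ (D,v) ∈ K, P(D,v) ≤ 1`. -/
theorem sum_incompatible_probs_le_one {ι : Type*} [Fintype ι] [DecidableEq ι]
    (p : ι → ℝ) (h0 : ∀ i, 0 ≤ p i) (h1 : ∀ i, p i ≤ 1)
    (K : Finset (Finset ι × (ι → Bool)))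
    (hinc : ∀ c₁ ∈ K, ∀ c₂ ∈ K, c₁ ≠ c₂ →
      ∃ i ∈ c₁.1 ∩ c₂.1, c₁.2 i ≠ c₂.2 i) :
    ∑ c ∈ K, (∏ i ∈ c.1.filter (fun i => c.2 i = true), p i) *
        ∏ i ∈ c.1.filter (fun i => c.2 i = false), (1 - p i) ≤ 1 := by
  have hdisj : (K : Set (Finset ι × (ι → Bool))).PairwiseDisjoint choiceCylinder := by
    intro c₁ hc₁ c₂ hc₂ hne
    obtain ⟨i, hi, hv⟩ := hinc c₁ hc₁ c₂ hc₂ hne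
    rw [Finset.mem_inter] at hi
    refine Finset.disjoint_left.2 fun w hw₁ hw₂ => hv ?_
    rw [← apply_eq_of_mem_choiceCylinder hw₁ hi.1, apply_eq_of_mem_choiceCylinder hw₂ hi.2]
  simp_rw [← sum_choiceCylinder_boolWeight p]
  rw [← Finset.sum_biUnion hdisj, ← sum_prod_boolWeight p]
  exact Finset.sum_le_sum_of_subset_of_nonneg (Finset.subset_univ _) fun w _ _ =>
    Finset.prod_nonneg fun i _ => boolWeight_nonneg h0 h1 i (w i)
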